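/- In the exterior Dirichlet setting, there is a constant c independent of R such that for every R > 4R₀ and every solution u^R of the compact Dirichlet problem, |Du^R(x)| ≤ c for all x ∈ B_R∖int K. -/

import Mathlib

open Metric Set Filter
open scoped Topology RealInnerProductSpace

noncomputable section

abbrev Euc (n : ℕ) : Type := EuclideanSpace ℝ (Fin n)

/-- The Hessian matrix of `u` at `x`, `(u_{ij})`. -/
noncomputable def Hess {n : ℕ} (u : Euc n → ℝ) (x : Euc n) : Matrix (Fin n) (Fin n) ℝ :=
  fun i j => iteratedFDeriv ℝ 2 u x ![EuclideanSpace.single i 1, EuclideanSpace.single j 1]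

/-- The Gauß curvature operator `K[u] = det D²u / (1+|Du|²)^((n+2)/2)`. -/
noncomputable def gaussK {n : ℕ} (u : Euc n → ℝ) (x : Euc n) : ℝ :=
  (Hess u x).det / (1 + ‖fderiv ℝ u x‖ ^ 2) ^ (((n : ℝ) + 2) / 2)

/-- Partial derivative `w_i` relative to a set `S`. -/
noncomputable def pdW {n : ℕ} (S : Set (Euc n)) (w : Euc n → ℝ) (x : Euc n) (i : Fin n) : ℝ :=
  fderivWithin ℝ w S x (EuclideanSpace.single i 1)

/-- The Hessian matrix `(w_{ij})` relative to a set `S`. -/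
noncomputable def HessW {n : ℕ} (S : Set (Euc n)) (w : Euc n → ℝ) (x : Euc n) :
    Matrix (Fin n) (Fin n) ℝ :=
  fun i j => iteratedFDerivWithin ℝ 2 w S x
    ![EuclideanSpace.single i 1, EuclideanSpace.single j 1]

/-- The exterior Dirichlet setting of Finster–Schnürer. -/
structure ExtSetting (n : ℕ) where
  K : Set (Euc n)
  f : Euc n → ℝ → ℝ
  u₀ : Euc n → ℝ
  ul : Euc n → ℝ
  R₀ : ℝ
  hn : 2 ≤ n
  hR₀ : 0 < R₀
  hKne : K.Nonempty
  hKc : IsCompact K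
  hK0 : 0 ∈ interior K
  hKsm : ∃ g : Euc n → ℝ, ContDiff ℝ (⊤ : ℕ∞) g ∧ K = {x | g x ≤ 0} ∧
    ∀ x ∈ frontier K, fderiv ℝ g x ≠ 0
  hKR₀ : K ⊆ ball 0 R₀
  hfsm : ContDiffOn ℝ (⊤ : ℕ∞) (fun p : Euc n × ℝ => f p.1 p.2) ((interior K)ᶜ ×ˢ univ)
  hfpos : ∀ x ∈ (interior K)ᶜ, ∀ z : ℝ, 0 < f x z
  hfz : ∀ x ∈ (interior K)ᶜ, Monotone (f x)
  hfdec : ∃ C : ℝ, ∀ x ∈ (interior K)ᶜ, ∀ z : ℝ, f x z * ‖x‖ ^ (n + 1) ≤ C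
  hfder : ∃ C : ℝ, ∀ p ∈ (interior K)ᶜ ×ˢ (univ : Set ℝ),
    ‖fderivWithin ℝ (fun q : Euc n × ℝ => f q.1 q.2) ((interior K)ᶜ ×ˢ univ) p‖ +
      ‖iteratedFDerivWithin ℝ 2 (fun q : Euc n × ℝ => f q.1 q.2) ((interior K)ᶜ ×ˢ univ) p‖
        ≤ C * f p.1 p.2
  hulsm : ContDiffOn ℝ (⊤ : ℕ∞) ul (interior K)ᶜ
  hulconv : ∀ x ∈ Kᶜ, (Hess ul x).PosDef
  hulsub : ∀ x ∈ Kᶜ, f x (ul x) ≤ gaussK ul x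
  hulbc : ∀ x ∈ frontier K, ul x = u₀ x
  hulcone : ∃ C : ℝ, ∀ x ∈ (interior K)ᶜ, |ul x - ‖x‖| ≤ C
  huldec1 : ∃ C R₁ : ℝ, ∀ x : Euc n, R₁ ≤ ‖x‖ →
    ‖fderiv ℝ (fun y => ul y - ‖y‖) x‖ ≤ C / ‖x‖
  huldec2 : ∃ C R₁ : ℝ, ∀ x : Euc n, R₁ ≤ ‖x‖ →
    ‖iteratedFDeriv ℝ 2 (fun y => ul y - ‖y‖) x‖ + ‖iteratedFDeriv ℝ 3 ul x‖ ≤ C / ‖x‖ ^ 2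

/-- The domain `B_R ∖ int K` of the compact Dirichlet problem. -/
def solDom {n : ℕ} (S : ExtSetting n) (R : ℝ) : Set (Euc n) :=
  closedBall 0 R \ interior S.K

/-- `u` is a smooth strictly convex solution `u^R` of the compact Dirichlet problem
`K[u^R] = f(x,u^R)` in `B_R ∖ K`, `u^R = u̲` on `∂B_R ∪ ∂K`. -/
def IsSol {n : ℕ} (S : ExtSetting n) (R : ℝ) (u : Euc n → ℝ) : Prop :=
  ContDiffOn ℝ (⊤ : ℕ∞) u (solDom S R) ∧
  (∀ x ∈ ball 0 R \ S.K, (Hess u x).PosDef) ∧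
  (∀ x ∈ ball 0 R \ S.K, gaussK u x = S.f x (u x)) ∧
  (∀ x ∈ sphere (0 : Euc n) R ∪ frontier S.K, u x = S.ul x)

lemma det_add_vecMulVec {m : Type*} [Fintype m] [DecidableEq m] {B : Matrix m m ℝ}
    (hB : B.PosDef) (v : m → ℝ) :
    (B + Matrix.vecMulVec v v).det = B.det * (1 + v ⬝ᵥ (B⁻¹.mulVec v)) := by
  rw [Matrix.vecMulVec_eq Unit,
    Matrix.det_add_replicateCol_mul_replicateRow hB.det_pos.ne'.isUnit,
    Matrix.det_unique (n := Unit)]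
  congr 1
  simp [Matrix.mul_apply, dotProduct, Matrix.mulVec, Finset.sum_mul, Finset.mul_sum, mul_assoc]
  rw [Finset.sum_comm]

lemma det_le_det_add_posSemidef {m : Type*} [Fintype m] [DecidableEq m] {B P : Matrix m m ℝ}
    (hB : B.PosDef) (hP : P.PosSemidef) : B.det ≤ (B + P).det := by
  obtain ⟨k, v, rfl⟩ := Matrix.posSemidef_iff_eq_sum_vecMulVec.1 hP
  have key : ∀ s : Finset (Fin k), (B + ∑ i ∈ s, Matrix.vecMulVec (v i) (star (v i))).PosDef ∧
      B.det ≤ (B + ∑ i ∈ s, Matrix.vecMulVec (v i) (star (v i))).det := by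
    intro s
    induction s using Finset.induction_on with
    | empty => simpa using hB
    | insert i s hi ih =>
      rw [Finset.sum_insert hi, add_comm (Matrix.vecMulVec _ _), ← add_assoc]
      refine ⟨ih.1.add_posSemidef (Matrix.posSemidef_vecMulVec_self_star (v i)), ih.2.trans ?_⟩
      have h := ih.1.inv.posSemidef.dotProduct_mulVec_nonneg (v i)
      simp only [star_trivial] at h ih ⊢
      rw [det_add_vecMulVec ih.1]
      nlinarith [ih.1.det_pos]
  exact (key _).2

lemma dotProduct_hess_mulVec {n : ℕ} (u : Euc n → ℝ) (x : Euc n) (v : Fin n → ℝ) :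
    v ⬝ᵥ (Hess u x).mulVec v =
      fderiv ℝ (fderiv ℝ u) x (WithLp.toLp 2 v) (WithLp.toLp 2 v) := by
  have hv : WithLp.toLp 2 v = ∑ i, v i • (EuclideanSpace.single i 1 : Euc n) := by
    ext j
    simp [Pi.single_apply]
  rw [hv]
  simp only [map_sum, map_smul, sum_apply, smul_apply,
    dotProduct, Matrix.mulVec, Hess, iteratedFDeriv_two_apply, Finset.mul_sum, smul_eq_mul]
  rw [Finset.sum_comm]
  refine Finset.sum_congr rfl fun i _ => Finset.sum_congr rfl fun j _ => ?_
  simp only [Matrix.cons_val_zero, Matrix.cons_val_one]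
  ring

lemma ContDiffAt.hasDerivAt_line {E : Type*} [NormedAddCommGroup E] [NormedSpace ℝ E]
    {u : E → ℝ} {x v : E} {t : ℝ} (h : ContDiffAt ℝ 2 u (x + t • v)) :
    HasDerivAt (fun s : ℝ => u (x + s • v)) (fderiv ℝ u (x + t • v) v) t ∧
    HasDerivAt (fun s : ℝ => fderiv ℝ u (x + s • v) v)
      (fderiv ℝ (fderiv ℝ u) (x + t • v) v v) t := by
  have hl : HasDerivAt (fun s : ℝ => x + s • v) v t := by
    simpa using ((hasDerivAt_id t).smul_const v).const_add x
  refine ⟨(h.differentiableAt (by norm_num)).hasFDerivAt.comp_hasDerivAt t hl, ?_⟩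
  have h1 : DifferentiableAt ℝ (fderiv ℝ u) (x + t • v) :=
    (h.fderiv_right (m := 1) (by norm_num)).differentiableAt (by norm_num)
  have h2 : HasDerivAt (fun s : ℝ => fderiv ℝ u (x + s • v))
      (fderiv ℝ (fderiv ℝ u) (x + t • v) v) t := h1.hasFDerivAt.comp_hasDerivAt t hl
  simpa using h2.clm_apply (hasDerivAt_const t v)

lemma IsLocalMin.second_deriv_nonneg {h h' : ℝ → ℝ} {a c : ℝ} (hm : IsLocalMin h a)
    (hd : ∀ᶠ t in 𝓝 a, HasDerivAt h (h' t) t) (hd2 : HasDerivAt h' c a) : 0 ≤ c := by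
  by_contra! hc
  have e1 : deriv h =ᶠ[𝓝 a] h' := hd.mono fun t ht => ht.deriv
  have e2 : deriv (deriv h) a = c := by rw [e1.deriv_eq, hd2.deriv]
  have hmax := isLocalMax_of_deriv_deriv_neg (by rw [e2]; exact hc) hm.deriv_eq_zero
    hd.self_of_nhds.continuousAt
  have hconst : h =ᶠ[𝓝 a] fun _ => h a := by
    filter_upwards [hm, hmax] with t h1 h2 using le_antisymm h2 h1
  have e3 : deriv h =ᶠ[𝓝 a] fun _ => 0 := by
    filter_upwards [hconst.eventuallyEq_nhds] with t ht
    rw [ht.deriv_eq, deriv_const]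
  rw [e3.deriv_eq, deriv_const] at e2
  exact hc.ne e2.symm

lemma div_rpow_lt_div_rpow_of_perturbation {a b s M p c l d d' : ℝ} (ha : 0 ≤ a) (haM : a ≤ M)
    (hb : 0 ≤ b) (hbs : b ≤ a + s) (hs : 0 < s) (hs1 : s ≤ 1) (hp : 0 ≤ p) (hd : 0 < d)
    (hd' : d * (1 + l * s * c) ≤ d') (hl : 2 * (p * (2 * M + 1)) < l * c)
    (hps : p * (2 * M + 1) * s ≤ 1) :
    d / (1 + a ^ 2) ^ p < d' / (1 + b ^ 2) ^ p := by
  have hM : 0 ≤ M := ha.trans haM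
  have h1 : 1 + b ^ 2 ≤ (1 + a ^ 2) * (1 + s * (2 * M + 1)) := by
    have : b ^ 2 ≤ (a + s) ^ 2 := by gcongr
    have h2 : 2 * a * s ≤ 2 * M * s := by gcongr
    have h3 : 0 ≤ a ^ 2 * (s * (2 * M + 1)) := by positivity
    nlinarith
  have hq : 0 ≤ p * (2 * M + 1) * s := by positivity
  have h2 : (1 + b ^ 2) ^ p ≤ (1 + a ^ 2) ^ p * (1 + 2 * (p * (2 * M + 1) * s)) := by
    calc (1 + b ^ 2) ^ p ≤ ((1 + a ^ 2) * (1 + s * (2 * M + 1))) ^ p := by gcongr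
      _ = (1 + a ^ 2) ^ p * (1 + s * (2 * M + 1)) ^ p :=
        Real.mul_rpow (by positivity) (by positivity)
      _ ≤ (1 + a ^ 2) ^ p * Real.exp (s * (2 * M + 1)) ^ p := by
        gcongr
        linarith [Real.add_one_le_exp (s * (2 * M + 1))]
      _ = (1 + a ^ 2) ^ p * Real.exp (p * (2 * M + 1) * s) := by
        rw [← Real.exp_mul]; ring_nf
      _ ≤ (1 + a ^ 2) ^ p * (1 + 2 * (p * (2 * M + 1) * s)) := by
        gcongr
        have := (abs_le.1 (Real.abs_exp_sub_one_le (abs_le.2 ⟨by linarith, hps⟩))).2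
        rw [abs_of_nonneg hq] at this
        linarith
  have hA : 0 < (1 + a ^ 2) ^ p := by positivity
  rw [div_lt_div_iff₀ hA (by positivity)]
  have h3 : 1 + 2 * (p * (2 * M + 1) * s) < 1 + l * s * c := by nlinarith
  calc d * (1 + b ^ 2) ^ p ≤ d * ((1 + a ^ 2) ^ p * (1 + 2 * (p * (2 * M + 1) * s))) := by gcongr
    _ < d * ((1 + a ^ 2) ^ p * (1 + l * s * c)) := by gcongr
    _ = d * (1 + l * s * c) * (1 + a ^ 2) ^ p := by ring
    _ ≤ d' * (1 + a ^ 2) ^ p := by gcongr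

/-- First and second order conditions at a local minimum of `u - w - ε exp (l xᵢ)`. -/
lemma fderiv_and_det_hess_of_isLocalMin {n : ℕ} (i : Fin n) {u w : Euc n → ℝ} {x : Euc n} {ε l : ℝ}
    (hε : 0 < ε) (hl : 0 < l) (hu : ContDiffAt ℝ 2 u x) (hw : ContDiffAt ℝ 2 w x)
    (hup : (Hess u x).PosDef) (hwp : (Hess w x).PosDef)
    (hmin : IsLocalMin (fun y => u y - w y - ε * Real.exp (l * y i)) x) :
    ‖fderiv ℝ u x‖ ≤ ‖fderiv ℝ w x‖ + ε * l * Real.exp (l * x i) ∧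
    (Hess w x).det * (1 + l * (ε * l * Real.exp (l * x i)) *
      (Pi.single i 1 ⬝ᵥ ((Hess w x)⁻¹.mulVec (Pi.single i 1)))) ≤ (Hess u x).det := by
  have he : ∀ (v : Euc n) (t : ℝ), HasDerivAt (fun t : ℝ => Real.exp (l * (x + t • v) i))
      (Real.exp (l * (x + t • v) i) * (l * v i)) t := by
    intro v t
    refine HasDerivAt.exp ?_
    simpa using (((hasDerivAt_id t).mul_const (v i)).const_add (x i)).const_mul l
  have hl0 : ∀ v : Euc n, Tendsto (fun t : ℝ => x + t • v) (𝓝 0) (𝓝 x) := by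
    intro v
    have : ContinuousAt (fun t : ℝ => x + t • v) 0 := by fun_prop
    simpa [ContinuousAt] using this
  have hlm : ∀ v : Euc n, IsLocalMin
      (fun t : ℝ => u (x + t • v) - w (x + t • v) - ε * Real.exp (l * (x + t • v) i)) 0 := by
    intro v
    have := (hl0 v).eventually hmin
    simpa [IsLocalMin, IsMinFilter] using this
  have hder : ∀ v : Euc n, ∀ᶠ t in 𝓝 (0 : ℝ), HasDerivAt
      (fun t : ℝ => u (x + t • v) - w (x + t • v) - ε * Real.exp (l * (x + t • v) i))
      (fderiv ℝ u (x + t • v) v - fderiv ℝ w (x + t • v) v -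
        ε * (Real.exp (l * (x + t • v) i) * (l * v i))) t := by
    intro v
    filter_upwards [(hl0 v).eventually (hu.eventually (by simp)),
      (hl0 v).eventually (hw.eventually (by simp))] with t h1 h2
    exact (h1.hasDerivAt_line.1.sub h2.hasDerivAt_line.1).sub ((he v t).const_mul ε)
  have h1 : ∀ v : Euc n, fderiv ℝ u x v = fderiv ℝ w x v +
      ε * l * Real.exp (l * x i) * v i := by
    intro v
    have := (hlm v).hasDerivAt_eq_zero (hder v).self_of_nhds
    simp only [zero_smul, add_zero] at this
    linarith
  have h2 : ∀ v : Euc n, 0 ≤ fderiv ℝ (fderiv ℝ u) x v v - fderiv ℝ (fderiv ℝ w) x v v -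
      l * (ε * l * Real.exp (l * x i)) * (v i * v i) := by
    intro v
    have hu' : ContDiffAt ℝ 2 u (x + (0 : ℝ) • v) := by simpa using hu
    have hw' : ContDiffAt ℝ 2 w (x + (0 : ℝ) • v) := by simpa using hw
    have := (hlm v).second_deriv_nonneg (hder v)
      ((hu'.hasDerivAt_line.2.sub hw'.hasDerivAt_line.2).sub
        (((he v 0).mul_const (l * v i)).const_mul ε))
    simp only [zero_smul, add_zero] at this
    linarith
  have hs : 0 < ε * l * Real.exp (l * x i) := by positivity
  set s := ε * l * Real.exp (l * x i) with hs_def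
  constructor
  · refine ContinuousLinearMap.opNorm_le_bound _ (by positivity) fun v => ?_
    rw [h1 v, add_mul]
    refine (norm_add_le _ _).trans (add_le_add (ContinuousLinearMap.le_opNorm _ _) ?_)
    rw [norm_mul, Real.norm_of_nonneg hs.le]
    gcongr
    exact PiLp.norm_apply_le v i
  · have hls : 0 ≤ l * s := by positivity
    set e : Fin n → ℝ := Real.sqrt (l * s) • Pi.single i 1 with he_def
    have hee : (Matrix.vecMulVec e e).PosSemidef := by
      simpa using Matrix.posSemidef_vecMulVec_self_star e
    have hB : (Hess w x + Matrix.vecMulVec e e).PosDef := hwp.add_posSemidef hee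
    have hdec : Hess u x = (Hess w x + Matrix.vecMulVec e e) +
        (Hess u x - (Hess w x + Matrix.vecMulVec e e)) := by abel
    have hev : ∀ v : Fin n → ℝ, v ⬝ᵥ (Matrix.vecMulVec e e).mulVec v = l * s * (v i * v i) := by
      intro v
      rw [Matrix.vecMulVec_mulVec, he_def]
      simp only [op_smul_eq_smul, dotProduct_smul, smul_dotProduct, dotProduct_single,
        single_dotProduct, smul_eq_mul]
      linear_combination (v i * v i) * Real.mul_self_sqrt hls
    have hP : (Hess u x - (Hess w x + Matrix.vecMulVec e e)).PosSemidef := by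
      refine Matrix.PosSemidef.of_dotProduct_mulVec_nonneg
        (hup.isHermitian.sub hB.isHermitian) fun v => ?_
      rw [star_trivial, Matrix.sub_mulVec, Matrix.add_mulVec, dotProduct_sub, dotProduct_add,
        dotProduct_hess_mulVec, dotProduct_hess_mulVec, hev]
      have := h2 (WithLp.toLp 2 v)
      simp only [] at this
      linarith
    rw [hdec]
    refine le_trans (le_of_eq ?_) (det_le_det_add_posSemidef hB hP)
    rw [det_add_vecMulVec hwp, he_def]
    congr 2
    rw [Matrix.mulVec_smul, dotProduct_smul, smul_dotProduct, smul_smul, Real.mul_self_sqrt hls,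
      smul_eq_mul]

lemma continuousOn_hess {n : ℕ} {w : Euc n → ℝ} {A : Set (Euc n)}
    (hw : ∀ x ∈ A, ContDiffAt ℝ 2 w x) : ContinuousOn (Hess w) A := by
  refine continuousOn_pi.2 fun i => continuousOn_pi.2 fun j => ?_
  intro x hx
  have h2 : ContinuousAt (fderiv ℝ (fderiv ℝ w)) x :=
    (((hw x hx).fderiv_right (m := 1) (by norm_num)).fderiv_right (m := 0)
      (by norm_num)).continuousAt
  have : Hess w = fun x i j => fderiv ℝ (fderiv ℝ w) x (EuclideanSpace.single i 1)
      (EuclideanSpace.single j 1) := by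
    ext x i j
    simp [Hess, iteratedFDeriv_two_apply]
  rw [this]
  exact ((h2.clm_apply continuousAt_const).clm_apply continuousAt_const).continuousWithinAt

/-- Comparison principle for the Gauß curvature operator. -/
lemma le_of_gaussK_le {n : ℕ} (i : Fin n) {D Ω : Set (Euc n)} {u w : Euc n → ℝ}
    (hD : IsCompact D) (hΩ : IsOpen Ω) (hΩD : Ω ⊆ D)
    (hu : ContinuousOn u D) (hw : ContinuousOn w D)
    (hu2 : ∀ x ∈ Ω, ContDiffAt ℝ 2 u x) (hw2 : ∀ x ∈ Ω, ContDiffAt ℝ 2 w x)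
    (hup : ∀ x ∈ Ω, (Hess u x).PosDef) (hwp : ∀ x ∈ Ω, (Hess w x).PosDef)
    (hK : ∀ x ∈ Ω, u x < w x → gaussK u x ≤ gaussK w x)
    (hbd : ∀ x ∈ D \ Ω, w x ≤ u x) : ∀ x ∈ D, w x ≤ u x := by
  by_contra! hcon
  obtain ⟨x₁, hx₁, hlt⟩ := hcon
  obtain ⟨m, hm⟩ : ∃ m, m = w x₁ - u x₁ := ⟨_, rfl⟩
  have hm0 : 0 < m := by linarith
  have hcont : ContinuousOn (fun x => u x - w x) D := hu.sub hw
  set A : Set (Euc n) := D ∩ (fun x => u x - w x) ⁻¹' Iic (-m / 2) with hA_def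
  have hAc : IsCompact A := hD.of_isClosed_subset
    (hcont.preimage_isClosed_of_isClosed hD.isClosed isClosed_Iic) inter_subset_left
  have hAΩ : A ⊆ Ω := by
    rintro x ⟨hxD, hx⟩
    by_contra hxΩ
    have := hbd x ⟨hxD, hxΩ⟩
    simp only [mem_preimage, mem_Iic] at hx
    linarith
  have hAne : A.Nonempty := ⟨x₁, hx₁, by simp only [mem_preimage, mem_Iic]; linarith⟩
  have hwA : ∀ x ∈ A, ContDiffAt ℝ 2 w x := fun x hx => hw2 x (hAΩ hx)
  -- uniform bounds on the compact set `A`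
  obtain ⟨M, hM⟩ := hAc.exists_bound_of_continuousOn (f := fderiv ℝ w) fun x hx =>
    ((hwA x hx).fderiv_right (m := 1) (by norm_num)).continuousAt.continuousWithinAt
  obtain ⟨c, hc, hcA⟩ : ∃ c > 0, ∀ x ∈ A, c ≤
      Pi.single i 1 ⬝ᵥ ((Hess w x)⁻¹.mulVec (Pi.single i 1)) := by
    have hH := continuousOn_hess hwA
    have hdet : ∀ x ∈ A, 0 < (Hess w x).det := fun x hx => (hwp x (hAΩ hx)).det_pos
    have hdc : ContinuousOn (fun x => (Hess w x).det) A :=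
      (Continuous.matrix_det continuous_id).comp_continuousOn hH
    have hdc' : ContinuousOn (fun x => (Hess w x +
        Matrix.vecMulVec (Pi.single i 1) (Pi.single i 1)).det) A :=
      (Continuous.matrix_det (continuous_id.add continuous_const)).comp_continuousOn hH
    obtain ⟨y, hy, hymin⟩ := hAc.exists_isMinOn hAne
      (hdc'.div hdc fun x hx => (hdet x hx).ne')
    have hform : ∀ x ∈ A, (Hess w x +
        Matrix.vecMulVec (Pi.single i 1) (Pi.single i 1)).det / (Hess w x).det =
        1 + Pi.single i 1 ⬝ᵥ ((Hess w x)⁻¹.mulVec (Pi.single i 1)) := fun x hx => by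
      rw [det_add_vecMulVec (hwp x (hAΩ hx)), mul_div_cancel_left₀ _ (hdet x hx).ne']
    refine ⟨Pi.single i 1 ⬝ᵥ ((Hess w y)⁻¹.mulVec (Pi.single i 1)), ?_, fun x hx => ?_⟩
    · have := (hwp y (hAΩ hy)).inv.dotProduct_mulVec_pos (x := Pi.single i 1) (by simp)
      simpa using this
    · have := hymin hx
      simp only [mem_ofPred_eq, Pi.div_apply] at this
      rw [hform x hx, hform y hy] at this
      linarith
  have hM0 : 0 ≤ M := by
    obtain ⟨x, hx⟩ := hAne
    exact (norm_nonneg _).trans (hM x hx)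
  set p : ℝ := ((n : ℝ) + 2) / 2 with hp_def
  have hp : 0 ≤ p := by positivity
  set q : ℝ := p * (2 * M + 1) with hq_def
  have hq : 0 ≤ q := by positivity
  obtain ⟨l, hl_def⟩ : ∃ l, l = (2 * q + 1) / c := ⟨_, rfl⟩
  have hl : 0 < l := by rw [hl_def]; positivity
  have hlc : 2 * q < l * c := by rw [hl_def, div_mul_cancel₀ _ hc.ne']; linarith
  have hcoord : Continuous fun y : Euc n => Real.exp (l * y i) := by fun_prop
  obtain ⟨N, hN⟩ := hD.exists_bound_of_continuousOn hcoord.continuousOn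
  have hN' : ∀ x ∈ D, Real.exp (l * x i) ≤ N := fun x hx => (le_abs_self _).trans (hN x hx)
  have hN0 : 0 < N := (Real.exp_pos _).trans_le (hN' x₁ hx₁)
  obtain ⟨T, hT_def⟩ : ∃ T, T = 2 / m + l + q * l := ⟨_, rfl⟩
  have hT : 0 < T := by rw [hT_def]; positivity
  obtain ⟨ε, hε_def⟩ : ∃ ε, ε = 1 / (N * T) := ⟨_, rfl⟩
  have hε : 0 < ε := by rw [hε_def]; positivity
  have hεN : ε * N = 1 / T := by rw [hε_def]; field_simp
  have hεm : ε * N ≤ m / 2 := by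
    rw [hεN, div_le_iff₀ hT, hT_def]
    have : m / 2 * (2 / m) = 1 := by field_simp
    have : 0 ≤ m / 2 * (l + q * l) := by positivity
    linarith
  have hεl : ε * N * l ≤ 1 := by
    rw [hεN, one_div_mul_eq_div, div_le_one hT, hT_def]
    have : 0 ≤ 2 / m + q * l := by positivity
    linarith
  have hεq : q * (ε * N * l) ≤ 1 := by
    rw [hεN, one_div_mul_eq_div, ← mul_div_assoc, div_le_one hT, hT_def]
    have : 0 ≤ 2 / m + l := by positivity
    linarith
  obtain ⟨x, hxD, hxmin⟩ := hD.exists_isMinOn ⟨x₁, hx₁⟩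
    (hcont.sub (hcoord.continuousOn.const_smul ε))
  have hmin : ∀ y ∈ D, u x - w x - ε * Real.exp (l * x i) ≤ u y - w y - ε * Real.exp (l * y i) :=
    fun y hy => by simpa using hxmin hy
  have hxA : x ∈ A := by
    refine ⟨hxD, ?_⟩
    have h1 := hmin x₁ hx₁
    have h2 : ε * Real.exp (l * x i) ≤ ε * N := by gcongr; exact hN' x hxD
    have h3 : 0 < ε * Real.exp (l * x₁ i) := by positivity
    simp only [mem_preimage, mem_Iic]
    linarith
  have hxΩ := hAΩ hxA
  have hloc : IsLocalMin (fun y => u y - w y - ε * Real.exp (l * y i)) x := by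
    filter_upwards [hΩ.mem_nhds hxΩ] with y hy using hmin y (hΩD hy)
  obtain ⟨hg, hdet⟩ := fderiv_and_det_hess_of_isLocalMin i hε hl (hu2 x hxΩ) (hw2 x hxΩ)
    (hup x hxΩ) (hwp x hxΩ) hloc
  have hsN : ε * l * Real.exp (l * x i) ≤ ε * N * l := by
    have : ε * l * Real.exp (l * x i) ≤ ε * l * N := by gcongr; exact hN' x hxD
    linarith
  have hs : 0 < ε * l * Real.exp (l * x i) := by positivity
  have hdpos := (hwp x hxΩ).det_pos
  have hlt := div_rpow_lt_div_rpow_of_perturbation (p := p) (M := M) (c := c) (l := l)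
    (norm_nonneg (fderiv ℝ w x)) (hM x hxA)
    (norm_nonneg (fderiv ℝ u x)) hg hs (hsN.trans hεl) hp hdpos
    (le_trans (by gcongr; exact hcA x hxA) hdet) hlc
    (le_trans (by rw [← hq_def]; gcongr) hεq)
  have hxlt : u x < w x := by
    have := hxA.2
    simp only [mem_preimage, mem_Iic] at this
    linarith
  exact absurd (hK x hxΩ hxlt) (not_le.2 hlt)

lemma exists_exit_time {E : Type*} [NormedAddCommGroup E] [NormedSpace ℝ E] {Ω : Set E}
    (hΩ : IsOpen Ω) (hb : Bornology.IsBounded Ω) {x v : E} (hx : x ∈ Ω) (hv : v ≠ 0) :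
    ∃ T : ℝ, 0 < T ∧ x + T • v ∉ Ω ∧ ∀ t ∈ Ico 0 T, x + t • v ∈ Ω := by
  set Z : Set ℝ := Ici 0 ∩ (fun t : ℝ => x + t • v) ⁻¹' Ωᶜ with hZ
  have hZc : IsClosed Z := isClosed_Ici.inter (hΩ.isClosed_compl.preimage (by fun_prop))
  have hZb : BddBelow Z := ⟨0, fun t ht => ht.1⟩
  have hZne : Z.Nonempty := by
    obtain ⟨r, hr⟩ := hb.exists_norm_le
    have hv' : 0 < ‖v‖ := norm_pos_iff.2 hv
    have hr0 : 0 ≤ r := (norm_nonneg x).trans (hr x hx)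
    refine ⟨(2 * r + 1) / ‖v‖, by simp only [mem_Ici]; positivity, fun hmem => ?_⟩
    have h1 := hr _ hmem
    have h2 : ‖((2 * r + 1) / ‖v‖) • v‖ = 2 * r + 1 := by
      rw [norm_smul, Real.norm_of_nonneg (by positivity), div_mul_cancel₀ _ hv'.ne']
    have h3 := norm_sub_le (x + ((2 * r + 1) / ‖v‖) • v) x
    rw [add_sub_cancel_left, h2] at h3
    linarith [hr x hx]
  have hmem := hZc.csInf_mem hZne hZb
  refine ⟨sInf Z, lt_of_le_of_ne hmem.1 fun h0 => hmem.2 ?_, hmem.2, fun t ht => ?_⟩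
  · simpa [← h0] using hx
  · by_contra hcon
    exact absurd (csInf_le hZb ⟨ht.1, hcon⟩) (not_le.2 ht.2)

/-- A locally convex function lying above `w` and agreeing with `w` on the boundary inherits the
gradient bound of `w`. -/
lemma norm_fderiv_le_of_convex_of_boundary_eq {n : ℕ} {D Ω : Set (Euc n)} {u w : Euc n → ℝ} {c : ℝ}
    (hc : 0 ≤ c) (hD : IsCompact D) (hΩ : IsOpen Ω) (hΩD : Ω ⊆ D)
    (hu : ContinuousOn u D) (hw : ContinuousOn w D)
    (hu2 : ∀ x ∈ Ω, ContDiffAt ℝ 2 u x) (hw2 : ∀ x ∈ Ω, ContDiffAt ℝ 2 w x)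
    (hup : ∀ x ∈ Ω, (Hess u x).PosSemidef) (hwc : ∀ x ∈ Ω, ‖fderiv ℝ w x‖ ≤ c)
    (hle : ∀ x ∈ Ω, w x ≤ u x) (hbd : ∀ x ∈ D \ Ω, u x = w x) :
    ∀ x ∈ Ω, ‖fderiv ℝ u x‖ ≤ c := by
  intro x hx
  have key : ∀ v : Euc n, fderiv ℝ u x v ≤ c * ‖v‖ := by
    intro v
    rcases eq_or_ne v 0 with rfl | hv
    · simp
    obtain ⟨T, hT, hTΩ, hray⟩ := exists_exit_time hΩ (hD.isBounded.subset hΩD) hx hv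
    have hline : Continuous fun t : ℝ => x + t • v := by fun_prop
    have hTD : x + T • v ∈ D := by
      have h1 : T ∈ closure (Ico 0 T) := by
        rw [closure_Ico hT.ne]; exact right_mem_Icc.2 hT.le
      exact hD.isClosed.closure_subset_iff.2 hΩD
        (map_mem_closure (f := fun t : ℝ => x + t • v) hline h1 hray)
    have hmaps : MapsTo (fun t : ℝ => x + t • v) (Icc 0 T) D := by
      intro t ht
      rcases ht.2.lt_or_eq with h | rfl
      · exact hΩD (hray t ⟨ht.1, h⟩)
      · exact hTD
    obtain ⟨a, ha, hua⟩ := exists_hasDerivAt_eq_slope (fun t : ℝ => u (x + t • v))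
      (fun t => fderiv ℝ u (x + t • v) v) hT (hu.comp hline.continuousOn hmaps)
      fun t ht => (hu2 _ (hray t ⟨ht.1.le, ht.2⟩)).hasDerivAt_line.1
    obtain ⟨b, hb, hwb⟩ := exists_hasDerivAt_eq_slope (fun t : ℝ => w (x + t • v))
      (fun t => fderiv ℝ w (x + t • v) v) hT (hw.comp hline.continuousOn hmaps)
      fun t ht => (hw2 _ (hray t ⟨ht.1.le, ht.2⟩)).hasDerivAt_line.1
    have hd2 : ∀ t ∈ Ico 0 T, HasDerivAt (fun t : ℝ => fderiv ℝ u (x + t • v) v)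
        (fderiv ℝ (fderiv ℝ u) (x + t • v) v v) t :=
      fun t ht => (hu2 _ (hray t ht)).hasDerivAt_line.2
    have hmono : MonotoneOn (fun t : ℝ => fderiv ℝ u (x + t • v) v) (Ico 0 T) := by
      refine monotoneOn_of_deriv_nonneg (convex_Ico 0 T)
        (fun t ht => (hd2 t ht).continuousAt.continuousWithinAt)
        (fun t ht => (hd2 t (interior_subset ht)).differentiableAt.differentiableWithinAt)
        fun t ht => ?_
      have ht' := interior_subset ht
      rw [(hd2 t ht').deriv]
      have := (hup _ (hray t ht')).dotProduct_mulVec_nonneg v.ofLp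
      rwa [star_trivial, dotProduct_hess_mulVec] at this
    have h1 := hmono ⟨le_rfl, hT⟩ ⟨ha.1.le, ha.2⟩ ha.1.le
    simp only [zero_smul, add_zero, sub_zero] at h1 hua hwb
    have h2 : fderiv ℝ w (x + b • v) v ≤ c * ‖v‖ :=
      (le_abs_self _).trans (ContinuousLinearMap.le_of_opNorm_le _
        (hwc _ (hray b ⟨hb.1.le, hb.2⟩)) v)
    have h3 : (u (x + T • v) - u x) / T ≤ (w (x + T • v) - w x) / T := by
      rw [hbd _ ⟨hTD, hTΩ⟩]
      gcongr
      exact hle x hx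
    linarith
  refine ContinuousLinearMap.opNorm_le_bound _ hc fun v => abs_le.2 ⟨?_, key v⟩
  have := key (-v)
  rw [map_neg, norm_neg] at this
  linarith

lemma uniqueDiffWithinAt_of_fderiv_ne_zero {E : Type*} [NormedAddCommGroup E] [NormedSpace ℝ E]
    {g : E → ℝ} {x : E} {s : Set E} (hg : DifferentiableAt ℝ g x) (hx : fderiv ℝ g x ≠ 0)
    (hgx : g x = 0) (hcl : x ∈ closure s) (hs : {y | 0 < g y} ⊆ s) :
    UniqueDiffWithinAt ℝ s x := by
  have hcone : ∀ v : E, 0 < fderiv ℝ g x v → v ∈ tangentConeAt ℝ s x := by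
    intro v hv
    refine mem_tangentConeAt_of_add_smul_mem (l := 𝓝[>] (0 : ℝ)) (c := id)
      (tendsto_id'.2 (nhdsGT_le_nhdsNE 0)) ?_
    have hl : HasDerivAt (fun t : ℝ => x + t • v) v 0 := by
      simpa using ((hasDerivAt_id (0 : ℝ)).smul_const v).const_add x
    have hd : HasDerivAt (fun t : ℝ => g (x + t • v)) (fderiv ℝ g x v) 0 := by
      have hg' : HasFDerivAt g (fderiv ℝ g x) (x + (0 : ℝ) • v) := by
        simpa using hg.hasFDerivAt
      exact hg'.comp_hasDerivAt 0 hl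
    have hsl := (hasDerivAt_iff_tendsto_slope.1 hd).mono_left (nhdsGT_le_nhdsNE 0)
    filter_upwards [hsl.eventually (lt_mem_nhds hv), self_mem_nhdsWithin] with t ht ht0
    refine hs ?_
    simp only [slope_def_field, zero_smul, add_zero, hgx, sub_zero] at ht
    exact (div_pos_iff_of_pos_right ht0).1 ht
  refine ⟨?_, hcl⟩
  obtain ⟨v₀, hv₀⟩ : ∃ v, 0 < fderiv ℝ g x v := by
    obtain ⟨v, hv⟩ := DFunLike.ne_iff.1 hx
    rcases lt_or_gt_of_ne hv with h | h
    · exact ⟨-v, by simpa using h⟩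
    · exact ⟨v, h⟩
  have htop : Submodule.span ℝ (tangentConeAt ℝ s x) = ⊤ := by
    refine eq_top_iff.2 fun v _ => ?_
    set k : ℝ := (|fderiv ℝ g x v| + 1) / fderiv ℝ g x v₀ with hk
    have hk0 : k * fderiv ℝ g x v₀ = |fderiv ℝ g x v| + 1 := div_mul_cancel₀ _ hv₀.ne'
    have h1 : v + k • v₀ ∈ Submodule.span ℝ (tangentConeAt ℝ s x) := by
      refine Submodule.subset_span (hcone _ ?_)
      rw [map_add, map_smul, smul_eq_mul, hk0]
      linarith [neg_abs_le (fderiv ℝ g x v)]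
    have h2 : k • v₀ ∈ Submodule.span ℝ (tangentConeAt ℝ s x) :=
      Submodule.smul_mem _ _ (Submodule.subset_span (hcone _ hv₀))
    simpa using Submodule.sub_mem _ h1 h2
  rw [htop]
  exact dense_univ

namespace ExtSetting

variable {n : ℕ} (S : ExtSetting n)

lemma uniqueDiffWithinAt_compl {x : Euc n} (hx : x ∈ (interior S.K)ᶜ) :
    UniqueDiffWithinAt ℝ S.Kᶜ x := by
  by_cases hxK : x ∈ S.K
  · obtain ⟨g, hg, hK, hdg⟩ := S.hKsm
    have hfr : x ∈ frontier S.K := ⟨subset_closure hxK, hx⟩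
    have hcl : x ∈ closure S.Kᶜ := by rwa [closure_compl]
    have hpos : {y | 0 < g y} ⊆ S.Kᶜ := fun y hy hyK => by
      rw [hK] at hyK
      exact absurd (show g y ≤ 0 from hyK) (not_le.2 hy)
    refine uniqueDiffWithinAt_of_fderiv_ne_zero (hg.differentiable (by simp) x) (hdg x hfr)
      (le_antisymm (by rw [hK] at hxK; exact hxK) ?_) hcl hpos
    refine (isClosed_le continuous_const hg.continuous).closure_subset_iff.2 ?_ hcl
    intro y hy
    rw [hK] at hy
    exact (not_le.1 (show ¬ g y ≤ 0 from hy)).le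
  · exact S.hKc.isClosed.isOpen_compl.uniqueDiffWithinAt hxK

lemma exists_norm_fderiv_ul_le : ∃ c : ℝ, 0 ≤ c ∧ ∀ x ∈ S.Kᶜ, ‖fderiv ℝ S.ul x‖ ≤ c := by
  obtain ⟨C, R₁, hC⟩ := S.huldec1
  set E : Set (Euc n) := (interior S.K)ᶜ with hE
  have hKE : S.Kᶜ ⊆ E := compl_subset_compl.2 interior_subset
  have hUD : UniqueDiffOn ℝ E := fun x hx => (S.uniqueDiffWithinAt_compl hx).mono hKE
  have hcont := S.hulsm.continuousOn_fderivWithin hUD (by simp)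
  have hcpt : IsCompact (closedBall (0 : Euc n) (max R₁ 1) ∩ E) :=
    (isCompact_closedBall _ _).inter_right isOpen_interior.isClosed_compl
  obtain ⟨M, hM⟩ := hcpt.exists_bound_of_continuousOn (hcont.mono inter_subset_right)
  refine ⟨max M (|C| + 1), le_max_of_le_right (by positivity), fun x hx => ?_⟩
  have hxE : E ∈ 𝓝 x := mem_of_superset (S.hKc.isClosed.isOpen_compl.mem_nhds hx) hKE
  rcases le_or_gt ‖x‖ (max R₁ 1) with h | h
  · have := hM x ⟨by simpa using h, hKE hx⟩
    rw [fderivWithin_of_mem_nhds hxE] at this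
    exact le_max_of_le_left this
  · have hR : R₁ ≤ ‖x‖ := (le_max_left _ _).trans h.le
    have h1 : 1 ≤ ‖x‖ := (le_max_right _ _).trans h.le
    have hx0 : x ≠ 0 := norm_pos_iff.1 (by linarith)
    have hd1 : DifferentiableAt ℝ S.ul x := (S.hulsm.contDiffAt hxE).differentiableAt (by simp)
    have hd2 : DifferentiableAt ℝ (fun y : Euc n => ‖y‖) x :=
      (contDiffAt_norm ℝ hx0 (n := 1)).differentiableAt (by simp)
    have hsub : fderiv ℝ S.ul x =
        fderiv ℝ (fun y => S.ul y - ‖y‖) x + fderiv ℝ (fun y : Euc n => ‖y‖) x := by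
      rw [fderiv_fun_sub hd1 hd2, sub_add_cancel]
    have hn1 : ‖fderiv ℝ (fun y : Euc n => ‖y‖) x‖ ≤ 1 := by
      simpa using norm_fderiv_le_of_lipschitz ℝ (lipschitzWith_one_norm (E := Euc n)) (x₀ := x)
    have hn2 : C / ‖x‖ ≤ |C| := by
      rw [div_le_iff₀ (by linarith)]
      nlinarith [le_abs_self C, abs_nonneg C]
    refine le_max_of_le_right ?_
    rw [hsub]
    exact (norm_add_le _ _).trans (add_le_add ((hC x hR).trans hn2) hn1)

lemma uniqueDiffWithinAt_ball_diff {R : ℝ} (hR : 4 * S.R₀ < R) {x : Euc n} (hx : x ∈ solDom S R) :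
    UniqueDiffWithinAt ℝ (ball 0 R \ S.K) x := by
  have hR₀ := S.hR₀
  have hxR : ‖x‖ ≤ R := by simpa using hx.1
  rcases hxR.lt_or_eq with h | h
  · rw [sdiff_eq, inter_comm]
    exact (S.uniqueDiffWithinAt_compl hx.2).inter (isOpen_ball.mem_nhds (by simpa using h))
  · have hxK : x ∉ S.K := fun hK => by
      have := S.hKR₀ hK
      rw [mem_ball_zero_iff] at this
      linarith
    have hR0 : (0 : ℝ) < R := by linarith
    refine UniqueDiffWithinAt.inter (uniqueDiffWithinAt_convex (convex_ball 0 R) ?_ ?_)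
      (S.hKc.isClosed.isOpen_compl.mem_nhds hxK)
    · rw [isOpen_ball.interior_eq]
      exact nonempty_ball.2 hR0
    · rw [closure_ball _ hR0.ne']
      exact hx.1

end ExtSetting

theorem uniform_gradient_bound
    (n : ℕ) (S : ExtSetting n) :
    ∃ c : ℝ, ∀ R : ℝ, 4 * S.R₀ < R → ∀ u : Euc n → ℝ, IsSol S R u →
      ∀ x ∈ solDom S R, ‖fderivWithin ℝ u (solDom S R) x‖ ≤ c := by
  obtain ⟨c, hc, hulc⟩ := S.exists_norm_fderiv_ul_le
  refine ⟨c, fun R hR u hu => ?_⟩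
  obtain ⟨hsm, hconv, heq, hbc⟩ := hu
  set D := solDom S R with hD_def
  set Ω : Set (Euc n) := ball 0 R \ S.K with hΩ_def
  have hKopen := S.hKc.isClosed.isOpen_compl
  have hΩ : IsOpen Ω := isOpen_ball.sdiff S.hKc.isClosed
  have hΩD : Ω ⊆ D := fun x hx => ⟨ball_subset_closedBall hx.1, fun h => hx.2 (interior_subset h)⟩
  have hD : IsCompact D := (isCompact_closedBall _ _).diff isOpen_interior
  have hul : ContinuousOn S.ul D := S.hulsm.continuousOn.mono fun x hx => hx.2
  have hu2 : ∀ x ∈ Ω, ContDiffAt ℝ 2 u x := fun x hx =>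
    (hsm.contDiffAt (mem_of_superset (hΩ.mem_nhds hx) hΩD)).of_le (WithTop.coe_le_coe.2 le_top)
  have hul2 : ∀ x ∈ Ω, ContDiffAt ℝ 2 S.ul x := fun x hx =>
    (S.hulsm.contDiffAt (mem_of_superset (hKopen.mem_nhds hx.2)
      (compl_subset_compl.2 interior_subset))).of_le (WithTop.coe_le_coe.2 le_top)
  have hbd : ∀ x ∈ D \ Ω, u x = S.ul x := by
    rintro x ⟨⟨hxR, hxK⟩, hxΩ⟩
    refine hbc x ?_
    by_cases h : x ∈ S.K
    · exact Or.inr ⟨subset_closure h, hxK⟩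
    · refine Or.inl ?_
      have h1 : x ∉ ball (0 : Euc n) R := fun hb => hxΩ ⟨hb, h⟩
      simp only [mem_closedBall, mem_ball, mem_sphere, not_lt] at hxR h1 ⊢
      exact le_antisymm hxR h1
  have hcomp : ∀ x ∈ D, S.ul x ≤ u x :=
    le_of_gaussK_le ⟨0, by have := S.hn; omega⟩ hD hΩ hΩD hsm.continuousOn hul hu2 hul2 hconv
      (fun x hx => S.hulconv x hx.2)
      (fun x hx hlt => by
        rw [heq x hx]
        exact (S.hfz x (hΩD hx).2 hlt.le).trans (S.hulsub x hx.2))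
      (fun x hx => (hbd x hx).ge)
  have hint := norm_fderiv_le_of_convex_of_boundary_eq hc hD hΩ hΩD hsm.continuousOn hul hu2 hul2
    (fun x hx => (hconv x hx).posSemidef) (fun x hx => hulc x hx.2)
    (fun x hx => hcomp x (hΩD hx)) hbd
  have hUD := fun x (hx : x ∈ D) => S.uniqueDiffWithinAt_ball_diff hR hx
  have hcont := hsm.continuousOn_fderivWithin (fun x hx => (hUD x hx).mono hΩD) (by simp)
  intro x hx
  refine ContinuousWithinAt.closure_le (hUD x hx).mem_closure ((hcont x hx).mono hΩD).norm
    continuousWithinAt_const fun y hy => ?_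
  rw [fderivWithin_of_mem_nhds (mem_of_superset (hΩ.mem_nhds hy) hΩD)]
  exact hint y hy
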